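/- Let G be a bridgeless cubic graph with a flow partition into white vertices A and black vertices B arising from a minimum 2-factor with ω odd cycles, and let w be the ±5/3-valuation (w = −5/3 on A, +5/3 on B). If S ⊆ V is a minimal set violating the balanced condition (5/3)|b_S − a_S| > |∂_G(S)|, then |∂_G(S)| ≤ (5/2)ω − 2. -/

import Mathlib

variable {V : Type*} [Fintype V] [DecidableEq V]

/-- The edge cut `∂_G(X)`: the set of edges of `G` with exactly one end in `X`. -/
noncomputable def SimpleGraph.cutCard (G : SimpleGraph V) (X : Finset V) : ℕ :=
  {e ∈ G.edgeSet | ∃ x y : V, e = s(x, y) ∧ x ∈ X ∧ y ∉ X}.ncard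

omit [DecidableEq V] in
/-- In a matching, two neighbours of the same vertex coincide. -/
lemma SimpleGraph.eq_of_adj_of_ncard_le_one (M : SimpleGraph V)
    (hM : ∀ v, (M.neighborSet v).ncard ≤ 1) {v w w' : V} (h : M.Adj v w) (h' : M.Adj v w') :
    w = w' :=
  (Set.ncard_le_one (Set.toFinite _)).1 (hM v) w h w' h'

/-- In a matching that joins `p` to its complement, each `p`-vertex of `S` is either matched inside
`S`, contributes an edge to the cut of `S`, or is unmatched. -/
lemma SimpleGraph.card_filter_le_add_cutCard (M : SimpleGraph V)
    (hM : ∀ v, (M.neighborSet v).ncard ≤ 1) (p : V → Prop) [DecidablePred p]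
    (hp : ∀ v w, M.Adj v w → p v → ¬ p w) (U S : Finset V)
    (hU : ∀ v, p v → (∀ w, ¬ M.Adj v w) → v ∈ U) :
    (S.filter p).card ≤ (S.filter (fun v => ¬ p v)).card + M.cutCard S + U.card := by
  classical
  have hex : ∀ v, ∃ w, (∃ w', M.Adj v w') → M.Adj v w := fun v => by
    by_cases h : ∃ w', M.Adj v w'
    · exact ⟨h.choose, fun _ => h.choose_spec⟩
    · exact ⟨v, fun h' => absurd h' h⟩
  choose f hf using hex
  let inner := S.filter (fun v => p v ∧ M.Adj v (f v) ∧ f v ∈ S)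
  let outer := S.filter (fun v => p v ∧ M.Adj v (f v) ∧ f v ∉ S)
  have hsub : S.filter p ⊆ (inner ∪ outer) ∪ U := by
    intro v hv
    simp only [inner, outer, Finset.mem_union, Finset.mem_filter] at hv ⊢
    by_cases h : ∃ w, M.Adj v w
    · have := hf v h
      tauto
    · exact Or.inr (hU v hv.2 (not_exists.1 h))
  have hinner : inner.card ≤ (S.filter (fun v => ¬ p v)).card := by
    refine Finset.card_le_card_of_injOn f ?_ ?_
    · intro v hv
      simp only [inner, Finset.coe_filter, Set.mem_ofPred_eq] at hv ⊢
      exact ⟨hv.2.2.2, hp _ _ hv.2.2.1 hv.2.1⟩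
    · intro v hv w hw hvw
      simp only [inner, Finset.coe_filter, Set.mem_ofPred_eq] at hv hw
      exact M.eq_of_adj_of_ncard_le_one hM hv.2.2.1.symm (hvw ▸ hw.2.2.1.symm)
  have houter : outer.card ≤ M.cutCard S := by
    rw [← Set.ncard_coe_finset, SimpleGraph.cutCard]
    refine Set.ncard_le_ncard_of_injOn (fun v => s(v, f v)) ?_ ?_ (Set.toFinite _)
    · intro v hv
      simp only [outer, Finset.coe_filter, Set.mem_ofPred_eq] at hv
      exact ⟨hv.2.2.1, v, f v, rfl, hv.1, hv.2.2.2⟩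
    · intro v hv w hw hvw
      simp only [outer, Finset.coe_filter, Set.mem_ofPred_eq] at hv hw
      rcases Sym2.eq_iff.1 hvw with h | h
      · exact h.1
      · exact absurd (h.1 ▸ hv.1) hw.2.2.2
  have h₁ := Finset.card_le_card hsub
  have h₂ := Finset.card_union_le (inner ∪ outer) U
  have h₃ := Finset.card_union_le inner outer
  omega

omit [DecidableEq V] in
/-- Edge-disjoint subgraphs contribute disjointly to a cut. -/
lemma SimpleGraph.cutCard_add_cutCard_le (G M N : SimpleGraph V) (hM : M ≤ G) (hN : N ≤ G)
    (hdisj : ∀ v w, M.Adj v w → ¬ N.Adj v w) (S : Finset V) :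
    M.cutCard S + N.cutCard S ≤ G.cutCard S := by
  unfold SimpleGraph.cutCard
  rw [← Set.ncard_union_eq _ (Set.toFinite _) (Set.toFinite _)]
  · refine Set.ncard_le_ncard ?_ (Set.toFinite _)
    rintro e (⟨he, h⟩ | ⟨he, h⟩)
    · exact ⟨SimpleGraph.edgeSet_mono hM he, h⟩
    · exact ⟨SimpleGraph.edgeSet_mono hN he, h⟩
  · rw [Set.disjoint_left]
    rintro e ⟨he, x, y, rfl, -⟩ ⟨he', -⟩
    exact hdisj x y he he'

omit [Fintype V] in
/-- An involution exchanging `Z ∩ A` and `Z \ A` forces each of them to be half of `Z`. -/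
lemma Finset.two_mul_card_filter_of_involution (Z A : Finset V) (pair : V → V)
    (hpair : ∀ z ∈ Z, pair z ∈ Z ∧ pair (pair z) = z ∧ (z ∈ A ↔ pair z ∉ A)) :
    2 * (Z.filter (· ∈ A)).card = Z.card ∧ 2 * (Z.filter (· ∉ A)).card = Z.card := by
  have heq : (Z.filter (· ∈ A)).card = (Z.filter (· ∉ A)).card := by
    refine Finset.card_bij' (fun z _ => pair z) (fun z _ => pair z) ?_ ?_ ?_ ?_ <;>
      intro z hz <;> rw [Finset.mem_filter] at hz <;> have := hpair z hz.1
    · rw [Finset.mem_filter]; tauto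
    · rw [Finset.mem_filter]; tauto
    · exact this.2.1
    · exact this.2.1
  have hadd := Finset.card_filter_add_card_filter_not (s := Z) (· ∈ A)
  omega

/- STATEMENT 12: Let `G` be a bridgeless cubic graph with a flow partition into white
vertices `A` and black vertices `Aᶜ` arising from a minimum 2-factor with `ω` odd
cycles.  The flow partition is encoded through its canonical 4-coloring: the color-1
edges form a perfect matching `M1` joining white to black, the color-2 edges form a
partial matching `M2` joining white to black and edge-disjoint from `M1`, exactly the
`ω` vertices of `Z` miss color 2, and these come in white/black pairs (via the added
edges `f'_i`, colored 2, of the auxiliary graph `M_G`).  If `S ⊆ V` is a minimal set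
violating the balanced condition `(5/3)·|b_S − a_S| > |∂_G(S)|` for the ±5/3-valuation
(`w = −5/3` on `A`, `+5/3` on `B = Aᶜ`), then `|∂_G(S)| ≤ (5/2)·ω − 2`. -/
theorem statement12 (G : SimpleGraph V)
    (hcubic : ∀ v, (G.neighborSet v).ncard = 3)
    (hbridgeless : ∀ e ∈ G.edgeSet, ¬ G.IsBridge e)
    (A : Finset V)
    (M1 M2 : SimpleGraph V) (hM1G : M1 ≤ G) (hM2G : M2 ≤ G)
    (hdisj : ∀ v w, M1.Adj v w → ¬ M2.Adj v w)
    (hM1pm : ∀ v, (M1.neighborSet v).ncard = 1)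
    (hM1AB : ∀ v w, M1.Adj v w → (v ∈ A ↔ w ∉ A))
    (hM2AB : ∀ v w, M2.Adj v w → (v ∈ A ↔ w ∉ A))
    (hM2deg : ∀ v, (M2.neighborSet v).ncard ≤ 1)
    (ω : ℕ) (hω4 : 4 ≤ ω) (hωeven : Even ω)
    (Z : Finset V) (hZ : ∀ v, v ∈ Z ↔ (M2.neighborSet v).ncard = 0)
    (hZcard : Z.card = ω)
    (pair : V → V)
    (hpair : ∀ z ∈ Z, pair z ∈ Z ∧ pair (pair z) = z ∧ pair z ≠ z ∧ (z ∈ A ↔ pair z ∉ A))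
    (S : Finset V) (hconn : (G.induce (S : Set V)).Connected)
    (hviol : (5 / 3 : ℚ) * |((S.filter (· ∉ A)).card : ℚ) - ((S.filter (· ∈ A)).card : ℚ)| >
      (G.cutCard S : ℚ))
    (hmin : ∀ S' : Finset V, S'.card < S.card →
      ¬ ((5 / 3 : ℚ) * |((S'.filter (· ∉ A)).card : ℚ) - ((S'.filter (· ∈ A)).card : ℚ)| >
        (G.cutCard S' : ℚ))) :
    (G.cutCard S : ℚ) ≤ 5 / 2 * (ω : ℚ) - 2 := by
  have hM1deg : ∀ v, (M1.neighborSet v).ncard ≤ 1 := fun v => (hM1pm v).le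
  have hM1ex : ∀ v, ∃ w, M1.Adj v w := fun v =>
    Set.nonempty_of_ncard_ne_zero (s := M1.neighborSet v) (by rw [hM1pm v]; exact one_ne_zero)
  have hZmem : ∀ v, (∀ w, ¬ M2.Adj v w) → v ∈ Z := fun v h => by
    rw [hZ, Set.ncard_eq_zero (Set.toFinite _)]
    exact Set.eq_empty_iff_forall_notMem.2 h
  obtain ⟨hZA, hZB⟩ := Finset.two_mul_card_filter_of_involution Z A pair fun z hz =>
    ⟨(hpair z hz).1, (hpair z hz).2.1, (hpair z hz).2.2.2⟩
  have hA1 := M1.card_filter_le_add_cutCard hM1deg (· ∈ A)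
    (fun v w h hv => (hM1AB v w h).1 hv) ∅ S fun v _ h => absurd (hM1ex v) (not_exists.2 h)
  have hB1 := M1.card_filter_le_add_cutCard hM1deg (· ∉ A)
    (fun v w h hv hw => hv ((hM1AB v w h).2 hw)) ∅ S fun v _ h => absurd (hM1ex v) (not_exists.2 h)
  have hA2 := M2.card_filter_le_add_cutCard hM2deg (· ∈ A)
    (fun v w h hv => (hM2AB v w h).1 hv) (Z.filter (· ∈ A)) S
    fun v hv h => Finset.mem_filter.2 ⟨hZmem v h, hv⟩
  have hB2 := M2.card_filter_le_add_cutCard hM2deg (· ∉ A)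
    (fun v w h hv hw => hv ((hM2AB v w h).2 hw)) (Z.filter (· ∉ A)) S
    fun v hv h => Finset.mem_filter.2 ⟨hZmem v h, hv⟩
  have hcut := G.cutCard_add_cutCard_le M1 M2 hM1G hM2G hdisj S
  simp only [not_not, Finset.card_empty] at hA1 hB1 hA2 hB2
  rw [hZcard] at hZA hZB
  obtain ⟨h, rfl⟩ := hωeven
  generalize (S.filter (· ∈ A)).card = a at *
  generalize (S.filter (· ∉ A)).card = b at *
  generalize G.cutCard S = c at *
  have hbound : c + 2 ≤ 5 * h := by
    rcases abs_cases ((b : ℚ) - a) with ⟨habs, -⟩ | ⟨habs, -⟩ <;> rw [habs] at hviol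
    · have hlt : 3 * c + 5 * a < 5 * b := by
        have : (3 * c + 5 * a : ℚ) < 5 * b := by linarith
        exact_mod_cast this
      omega
    · have hlt : 3 * c + 5 * b < 5 * a := by
        have : (3 * c + 5 * b : ℚ) < 5 * a := by linarith
        exact_mod_cast this
      omega
  have hcast : (c + 2 : ℚ) ≤ 5 * h := by exact_mod_cast hbound
  push_cast
  linarith
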